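/- arXiv:1405.0676 — 4 statements merged into one kernel-verified Lean document; each statement's English description precedes it below -/
import Mathlib

section
/- The function τ(s,t) = max{σ(t, d(s,t)), σ(s, d(s,t))} satisfies the triangle inequality: for all s, t, u ∈ T, τ(s,u) ≤ τ(s,t) + τ(t,u); hence τ is a (pseudo)distance on T. -/
open MeasureTheory

section truncatedInfDist

variable {T : Type*} [PseudoMetricSpace T]

theorem min_infDist_le_add (A : Set T) {s t : T} {b c : ℝ} (hb : 0 ≤ b)
    (hc : c ≤ dist s t + b) :
    min (Metric.infDist s A) c ≤
      min (Metric.infDist s A) (dist s t) + min (Metric.infDist t A) b := by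
  have h : Metric.infDist s A ≤ Metric.infDist t A + dist s t := Metric.infDist_le_infDist_add_dist
  have ht : 0 ≤ Metric.infDist t A := Metric.infDist_nonneg
  rcases min_cases (Metric.infDist s A) c with ⟨h₁, _⟩ | ⟨h₁, _⟩ <;>
  rcases min_cases (Metric.infDist s A) (dist s t) with ⟨h₂, _⟩ | ⟨h₂, _⟩ <;>
  rcases min_cases (Metric.infDist t A) b with ⟨h₃, _⟩ | ⟨h₃, _⟩ <;>
  linarith

theorem summable_mul_min_infDist {w : ℕ → ℝ} (hw : ∀ n, 0 ≤ w n) {A : ℕ → Set T} {t : T}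
    (h : Summable fun n => w n * Metric.infDist t (A n)) {a : ℝ} (ha : 0 ≤ a) :
    Summable fun n => w n * min (Metric.infDist t (A n)) a :=
  h.of_nonneg_of_le (fun n => mul_nonneg (hw n) (le_min Metric.infDist_nonneg ha))
    fun n => mul_le_mul_of_nonneg_left (min_le_left _ _) (hw n)

theorem tsum_mul_min_infDist_le_add {w : ℕ → ℝ} (hw : ∀ n, 0 ≤ w n) {A : ℕ → Set T}
    (h : ∀ t, Summable fun n => w n * Metric.infDist t (A n)) {s t : T} {b c : ℝ}
    (hb : 0 ≤ b) (hc₀ : 0 ≤ c) (hc : c ≤ dist s t + b) :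
    ∑' n, w n * min (Metric.infDist s (A n)) c ≤
      ∑' n, w n * min (Metric.infDist s (A n)) (dist s t) +
        ∑' n, w n * min (Metric.infDist t (A n)) b := by
  have h₁ := summable_mul_min_infDist hw (h s) (dist_nonneg (x := s) (y := t))
  have h₂ := summable_mul_min_infDist hw (h t) hb
  rw [← h₁.tsum_add h₂]
  refine (summable_mul_min_infDist hw (h s) hc₀).tsum_le_tsum (fun n => ?_) (h₁.add h₂)
  rw [← mul_add]
  exact mul_le_mul_of_nonneg_left (min_infDist_le_add (A n) hb hc) (hw n)

end truncatedInfDist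

/-- The function `τ(s,t) = max{σ(t, d(s,t)), σ(s, d(s,t))}`, where
`σ(t,a) = Σ_{n ≥ 0} 2ⁿ min{d(t, Tₙ), a}` for an admissible sequence of nets `(Tₙ)`,
satisfies the triangle inequality `τ(s,u) ≤ τ(s,t) + τ(t,u)`; hence `τ` is a
(pseudo)distance on `T`. -/
theorem stmt_2
    {T : Type*} [MetricSpace T] [CompactSpace T]
    (ψ : ℝ → ℝ)
    (hψ0 : ψ 0 = 0) (hψ1 : ψ 1 = 1)
    (hψconv : ConvexOn ℝ (Set.Ici 0) ψ)
    (hψmono : StrictMonoOn ψ (Set.Ici 0))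
    (Tn : ℕ → Finset T)
    (hcard0 : (Tn 0).card ≤ 1)
    (hcard : ∀ n : ℕ, 1 ≤ n → ((Tn n).card : ℝ) ≤ ψ ((2:ℝ) ^ n))
    (hTmono : ∀ n, Tn n ⊆ Tn (n + 1))
    (hTdense : Dense (⋃ n, (Tn n : Set T)))
    (hσsum : ∀ t : T, Summable fun n : ℕ => (2:ℝ) ^ n * Metric.infDist t (Tn n))
    (σ : T → ℝ → ℝ)
    (hσ : ∀ t a, σ t a = ∑' n : ℕ, (2:ℝ) ^ n * min (Metric.infDist t (Tn n)) a)
    (τ : T → T → ℝ)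
    (hτ : ∀ s t, τ s t = max (σ t (dist s t)) (σ s (dist s t))) :
    ∀ s t u : T, τ s u ≤ τ s t + τ t u := by
  have hσ_add : ∀ (s t : T) (b c : ℝ), 0 ≤ b → 0 ≤ c → c ≤ dist s t + b →
      σ s c ≤ σ s (dist s t) + σ t b := by
    intro s t b c hb hc₀ hc
    simp only [hσ]
    exact tsum_mul_min_infDist_le_add (fun n => by positivity) hσsum hb hc₀ hc
  intro s t u
  simp only [hτ]
  refine max_le ?_ ?_
  · have h := hσ_add u t (dist s t) (dist s u) dist_nonneg dist_nonneg
      (by linarith [dist_triangle s t u, dist_comm t u])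
    rw [dist_comm u t] at h
    linarith [le_max_left (σ t (dist s t)) (σ s (dist s t)),
      le_max_left (σ u (dist t u)) (σ t (dist t u))]
  · have h := hσ_add s t (dist t u) (dist s u) dist_nonneg dist_nonneg (dist_triangle s t u)
    linarith [le_max_right (σ t (dist s t)) (σ s (dist s t)),
      le_max_right (σ u (dist t u)) (σ t (dist t u))]
end

section
/- For all s, t ∈ T, the combined index k(s,t) lies between the single-distance indices: min{k¹(s,t), k²(s,t)} ≤ k(s,t) ≤ max{k¹(s,t), k²(s,t)}. -/
open MeasureTheory

/-- The distance to an increasing sequence of nonempty finite sets is nonincreasing. -/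
theorem antitone_sInf_image {T : Type*} (f : T → ℝ) (hf : ∀ y, 0 ≤ f y) (Tn : ℕ → Finset T)
    (hTne : ∀ n, (Tn n).Nonempty) (hTmono : ∀ n, Tn n ⊆ Tn (n + 1)) :
    Antitone fun n => sInf (f '' (Tn n : Set T)) := by
  refine antitone_nat_of_succ_le fun n => ?_
  refine csInf_le_csInf ⟨0, ?_⟩ ((Finset.coe_nonempty.mpr (hTne n)).image f)
    (Set.image_mono (Finset.coe_subset.mpr (hTmono n)))
  rintro _ ⟨y, -, rfl⟩
  exact hf y

/-- For all `s, t ∈ T`, the combined index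
`k(s,t) = max{k : Σⱼ Σ_{x∈{s,t}} 2^{pⱼk} dⱼ(x,Tₖ) ≥ Σⱼ 2^{pⱼk} dⱼ(s,t)}` lies between the
single-distance indices `kʲ(s,t) = max{k : dⱼ(s,Tₖ) + dⱼ(t,Tₖ) ≥ dⱼ(s,t)}`:
`min{k¹(s,t), k²(s,t)} ≤ k(s,t) ≤ max{k¹(s,t), k²(s,t)}`. -/
theorem stmt_10
    {T : Type*} (d₁ d₂ : T → T → ℝ)
    (hd₁0 : ∀ x y, 0 ≤ d₁ x y) (hd₁symm : ∀ x y, d₁ x y = d₁ y x)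
    (hd₁refl : ∀ x, d₁ x x = 0) (hd₁tri : ∀ x y z, d₁ x z ≤ d₁ x y + d₁ y z)
    (hd₂0 : ∀ x y, 0 ≤ d₂ x y) (hd₂symm : ∀ x y, d₂ x y = d₂ y x)
    (hd₂refl : ∀ x, d₂ x x = 0) (hd₂tri : ∀ x y z, d₂ x z ≤ d₂ x y + d₂ y z)
    (p₁ p₂ : ℝ) (hp₁ : 1 ≤ p₁) (hp₂ : 1 ≤ p₂)
    (Tn : ℕ → Finset T)
    (hTne : ∀ n, (Tn n).Nonempty)
    (hTmono : ∀ n, Tn n ⊆ Tn (n + 1))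
    (hTdense : ∀ x : T, ∀ ε > (0:ℝ), ∃ n, ∃ u ∈ Tn n, d₁ x u < ε ∧ d₂ x u < ε)
    (D₁ D₂ : T → ℕ → ℝ)
    (hD₁ : ∀ x n, D₁ x n = sInf ((d₁ x) '' (Tn n : Set T)))
    (hD₂ : ∀ x n, D₂ x n = sInf ((d₂ x) '' (Tn n : Set T)))
    (s t : T) (k k₁ k₂ : ℕ)
    (hk₁mem : D₁ s k₁ + D₁ t k₁ ≥ d₁ s t)
    (hk₁max : ∀ l : ℕ, D₁ s l + D₁ t l ≥ d₁ s t → l ≤ k₁)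
    (hk₂mem : D₂ s k₂ + D₂ t k₂ ≥ d₂ s t)
    (hk₂max : ∀ l : ℕ, D₂ s l + D₂ t l ≥ d₂ s t → l ≤ k₂)
    (hkmem : (2:ℝ) ^ (p₁ * k) * (D₁ s k + D₁ t k) + (2:ℝ) ^ (p₂ * k) * (D₂ s k + D₂ t k) ≥
      (2:ℝ) ^ (p₁ * k) * d₁ s t + (2:ℝ) ^ (p₂ * k) * d₂ s t)
    (hkmax : ∀ l : ℕ,
      (2:ℝ) ^ (p₁ * l) * (D₁ s l + D₁ t l) + (2:ℝ) ^ (p₂ * l) * (D₂ s l + D₂ t l) ≥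
        (2:ℝ) ^ (p₁ * l) * d₁ s t + (2:ℝ) ^ (p₂ * l) * d₂ s t → l ≤ k) :
    min k₁ k₂ ≤ k ∧ k ≤ max k₁ k₂ := by
  have anti₁ : ∀ x {m n : ℕ}, m ≤ n → D₁ x n ≤ D₁ x m := fun x m n h => by
    rw [hD₁, hD₁]
    exact antitone_sInf_image (d₁ x) (hd₁0 x) Tn hTne hTmono h
  have anti₂ : ∀ x {m n : ℕ}, m ≤ n → D₂ x n ≤ D₂ x m := fun x m n h => by
    rw [hD₂, hD₂]
    exact antitone_sInf_image (d₂ x) (hd₂0 x) Tn hTne hTmono h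
  have pos : ∀ a : ℝ, 0 < (2 : ℝ) ^ a := fun a => Real.rpow_pos_of_pos two_pos a
  constructor
  · apply hkmax
    have h₁ : d₁ s t ≤ D₁ s (min k₁ k₂) + D₁ t (min k₁ k₂) :=
      hk₁mem.le.trans (add_le_add (anti₁ s (min_le_left _ _)) (anti₁ t (min_le_left _ _)))
    have h₂ : d₂ s t ≤ D₂ s (min k₁ k₂) + D₂ t (min k₁ k₂) :=
      hk₂mem.le.trans (add_le_add (anti₂ s (min_le_right _ _)) (anti₂ t (min_le_right _ _)))
    exact add_le_add (mul_le_mul_of_nonneg_left h₁ (pos _).le)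
      (mul_le_mul_of_nonneg_left h₂ (pos _).le)
  · by_contra! h
    have h₁ : D₁ s k + D₁ t k < d₁ s t := by
      by_contra! h'
      exact absurd (hk₁max k h') (not_le.mpr ((le_max_left _ _).trans_lt h))
    have h₂ : D₂ s k + D₂ t k < d₂ s t := by
      by_contra! h'
      exact absurd (hk₂max k h') (not_le.mpr ((le_max_right _ _).trans_lt h))
    exact absurd hkmem (not_le.mpr (add_lt_add (mul_lt_mul_of_pos_left h₁ (pos _))
      (mul_lt_mul_of_pos_left h₂ (pos _))))
end

section
/- For all s, t ∈ T, τ₁(s,t) + τ₂(s,t) ≤ τ̄(s,t), i.e. the sum of the two single-distance continuity moduli is bounded by the combined deterministic bound τ̄. -/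
open MeasureTheory

/-- A truncated weighted series is at most the geometric sum of its first `k + 1` truncation
levels plus the untruncated tail. -/
theorem tsum_two_rpow_mul_min_le {p a : ℝ} (hp : 0 < p) (ha : 0 ≤ a) {f : ℕ → ℝ}
    (hf : ∀ n, 0 ≤ f n) (hsum : Summable fun n : ℕ => (2:ℝ) ^ (p * n) * f n) (k : ℕ) :
    ∑' n : ℕ, (2:ℝ) ^ (p * n) * min (f n) a ≤
      ∑' l : ℕ, (2:ℝ) ^ (p * ((l + (k + 1) : ℕ) : ℝ)) * f (l + (k + 1)) +
        ((2:ℝ) ^ (p * ((k : ℝ) + 1)) - 1) / ((2:ℝ) ^ p - 1) * a := by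
  have hmin : Summable fun n : ℕ => (2:ℝ) ^ (p * n) * min (f n) a :=
    hsum.of_nonneg_of_le
      (fun n => mul_nonneg (by positivity) (le_min (hf n) ha))
      (fun n => mul_le_mul_of_nonneg_left (min_le_left _ _) (by positivity))
  rw [← hmin.sum_add_tsum_nat_add (k + 1), add_comm]
  refine add_le_add ?_ ?_
  · exact ((summable_nat_add_iff (k + 1)).2 hmin).tsum_le_tsum
      (fun l => mul_le_mul_of_nonneg_left (min_le_left _ _) (by positivity))
      ((summable_nat_add_iff (k + 1)).2 hsum)
  · have hpow (n : ℕ) : (2:ℝ) ^ (p * n) = ((2:ℝ) ^ p) ^ n :=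
      Real.rpow_mul_natCast (by norm_num) p n
    have hne : (2:ℝ) ^ p ≠ 1 := (Real.one_lt_rpow (by norm_num) hp).ne'
    have hk := hpow (k + 1)
    push_cast at hk
    rw [hk, ← geom_sum_eq hne, Finset.sum_mul]
    refine Finset.sum_le_sum fun n _ => ?_
    rw [hpow]
    exact mul_le_mul_of_nonneg_left (min_le_right _ _) (by positivity)

/-- For all `s, t ∈ T`, `τ₁(s,t) + τ₂(s,t) ≤ τ̄(s,t)`: the sum of the two single-distance
continuity moduli `τⱼ(s,t) = max{σⱼ(t,dⱼ(s,t)), σⱼ(s,dⱼ(s,t))}`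
(`σⱼ(x,a) = Σₙ 2^{pⱼn} min{dⱼ(x,Tₙ), a}`) is bounded by the combined deterministic bound
`τ̄(s,t) = Σ_{x∈{s,t}} Σⱼ σʲ_{k(s,t)+1}(x) + Σⱼ ((2^{pⱼ(k(s,t)+1)}-1)/(2^{pⱼ}-1)) dⱼ(s,t)`. -/
theorem stmt_11
    {T : Type*} (d₁ d₂ : T → T → ℝ)
    (hd₁0 : ∀ x y, 0 ≤ d₁ x y) (hd₁symm : ∀ x y, d₁ x y = d₁ y x)
    (hd₁refl : ∀ x, d₁ x x = 0) (hd₁tri : ∀ x y z, d₁ x z ≤ d₁ x y + d₁ y z)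
    (hd₂0 : ∀ x y, 0 ≤ d₂ x y) (hd₂symm : ∀ x y, d₂ x y = d₂ y x)
    (hd₂refl : ∀ x, d₂ x x = 0) (hd₂tri : ∀ x y z, d₂ x z ≤ d₂ x y + d₂ y z)
    (p₁ p₂ : ℝ) (hp₁ : 1 ≤ p₁) (hp₂ : 1 ≤ p₂)
    (Tn : ℕ → Finset T)
    (hTne : ∀ n, (Tn n).Nonempty)
    (hTmono : ∀ n, Tn n ⊆ Tn (n + 1))
    (hTdense : ∀ x : T, ∀ ε > (0:ℝ), ∃ n, ∃ u ∈ Tn n, d₁ x u < ε ∧ d₂ x u < ε)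
    (D₁ D₂ : T → ℕ → ℝ)
    (hD₁ : ∀ x n, D₁ x n = sInf ((d₁ x) '' (Tn n : Set T)))
    (hD₂ : ∀ x n, D₂ x n = sInf ((d₂ x) '' (Tn n : Set T)))
    (hsum₁ : ∀ x, Summable fun n : ℕ => (2:ℝ) ^ (p₁ * n) * D₁ x n)
    (hsum₂ : ∀ x, Summable fun n : ℕ => (2:ℝ) ^ (p₂ * n) * D₂ x n)
    (σ₁ σ₂ : ℕ → T → ℝ)
    (hσ₁ : ∀ m x, σ₁ m x = ∑' l : ℕ, (2:ℝ) ^ (p₁ * ((l + m : ℕ) : ℝ)) * D₁ x (l + m))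
    (hσ₂ : ∀ m x, σ₂ m x = ∑' l : ℕ, (2:ℝ) ^ (p₂ * ((l + m : ℕ) : ℝ)) * D₂ x (l + m))
    (τ₁ τ₂ : T → T → ℝ)
    (hτ₁ : ∀ s t, τ₁ s t =
      max (∑' n : ℕ, (2:ℝ) ^ (p₁ * n) * min (D₁ t n) (d₁ s t))
          (∑' n : ℕ, (2:ℝ) ^ (p₁ * n) * min (D₁ s n) (d₁ s t)))
    (hτ₂ : ∀ s t, τ₂ s t =
      max (∑' n : ℕ, (2:ℝ) ^ (p₂ * n) * min (D₂ t n) (d₂ s t))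
          (∑' n : ℕ, (2:ℝ) ^ (p₂ * n) * min (D₂ s n) (d₂ s t)))
    (s t : T) (k : ℕ)
    (hkmem : (2:ℝ) ^ (p₁ * k) * (D₁ s k + D₁ t k) + (2:ℝ) ^ (p₂ * k) * (D₂ s k + D₂ t k) ≥
      (2:ℝ) ^ (p₁ * k) * d₁ s t + (2:ℝ) ^ (p₂ * k) * d₂ s t)
    (hkmax : ∀ l : ℕ,
      (2:ℝ) ^ (p₁ * l) * (D₁ s l + D₁ t l) + (2:ℝ) ^ (p₂ * l) * (D₂ s l + D₂ t l) ≥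
        (2:ℝ) ^ (p₁ * l) * d₁ s t + (2:ℝ) ^ (p₂ * l) * d₂ s t → l ≤ k) :
    τ₁ s t + τ₂ s t ≤
      (σ₁ (k + 1) s + σ₁ (k + 1) t + σ₂ (k + 1) s + σ₂ (k + 1) t) +
      ((2:ℝ) ^ (p₁ * ((k : ℝ) + 1)) - 1) / ((2:ℝ) ^ p₁ - 1) * d₁ s t +
      ((2:ℝ) ^ (p₂ * ((k : ℝ) + 1)) - 1) / ((2:ℝ) ^ p₂ - 1) * d₂ s t := by
  have hD₁0 (x : T) (n : ℕ) : 0 ≤ D₁ x n := by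
    rw [hD₁]
    exact Real.sInf_nonneg (Set.forall_mem_image.2 fun y _ => hd₁0 x y)
  have hD₂0 (x : T) (n : ℕ) : 0 ≤ D₂ x n := by
    rw [hD₂]
    exact Real.sInf_nonneg (Set.forall_mem_image.2 fun y _ => hd₂0 x y)
  have hσ₁0 (x : T) : 0 ≤ σ₁ (k + 1) x := by
    rw [hσ₁]
    exact tsum_nonneg fun l => mul_nonneg (by positivity) (hD₁0 x _)
  have hσ₂0 (x : T) : 0 ≤ σ₂ (k + 1) x := by
    rw [hσ₂]
    exact tsum_nonneg fun l => mul_nonneg (by positivity) (hD₂0 x _)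
  have h₁ (x : T) :=
    tsum_two_rpow_mul_min_le (by linarith) (hd₁0 s t) (hD₁0 x) (hsum₁ x) k
  have h₂ (x : T) :=
    tsum_two_rpow_mul_min_le (by linarith) (hd₂0 s t) (hD₂0 x) (hsum₂ x) k
  simp only [← hσ₁] at h₁
  simp only [← hσ₂] at h₂
  have hmax₁ : τ₁ s t ≤ σ₁ (k + 1) s + σ₁ (k + 1) t +
      ((2:ℝ) ^ (p₁ * ((k : ℝ) + 1)) - 1) / ((2:ℝ) ^ p₁ - 1) * d₁ s t := by
    rw [hτ₁]
    exact max_le (by linarith [h₁ t, hσ₁0 s]) (by linarith [h₁ s, hσ₁0 t])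
  have hmax₂ : τ₂ s t ≤ σ₂ (k + 1) s + σ₂ (k + 1) t +
      ((2:ℝ) ^ (p₂ * ((k : ℝ) + 1)) - 1) / ((2:ℝ) ^ p₂ - 1) * d₂ s t := by
    rw [hτ₂]
    exact max_le (by linarith [h₂ t, hσ₂0 s]) (by linarith [h₂ s, hσ₂0 t])
  linarith
end

section
/- For all s, t ∈ T, writing k₁ = k¹(s,t) and k₂ = k²(s,t), the combined bound τ̄ admits the upper estimate τ̄(s,t) ≤ 2(τ₁(s,t) + τ₂(s,t)) + (2^{p₂}/(2^{p₂}−1)) (2^{k₁p₂} − 2^{k₂p₂}) d₂(s,t) 1_{k₁≥k₂} + (2^{p₁}/(2^{p₁}−1)) (2^{k₂p₁} − 2^{k₁p₁}) d₁(s,t) 1_{k₂≥k₁}. -/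
open MeasureTheory

/-- The geometric series with ratio `r` whose coefficients are the constant `a` before the index
`m` and `u n` from the index `m` on. -/
noncomputable def cutSum (r a : ℝ) (u : ℕ → ℝ) (m : ℕ) : ℝ :=
  ∑ n ∈ Finset.range m, r ^ n * a + ∑' l : ℕ, r ^ (l + m) * u (l + m)

lemma cutSum_eq_add_sum_Ico {r a : ℝ} {u : ℕ → ℝ} (hu : Summable fun n : ℕ => r ^ n * u n)
    {k m : ℕ} (hkm : k ≤ m) :
    cutSum r a u m = cutSum r a u k + ∑ n ∈ Finset.Ico k m, r ^ n * (a - u n) := by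
  have hm := hu.sum_add_tsum_nat_add m
  have hk := hu.sum_add_tsum_nat_add k
  have hua := Finset.sum_range_add_sum_Ico (fun n => r ^ n * a) hkm
  have huu := Finset.sum_range_add_sum_Ico (fun n => r ^ n * u n) hkm
  simp only [cutSum, mul_sub, Finset.sum_sub_distrib]
  linarith

lemma cutSum_eq_tsum_min {r a : ℝ} {u : ℕ → ℝ} (hr : 0 ≤ r) (ha : 0 ≤ a) (hu0 : ∀ n, 0 ≤ u n)
    (hu : Summable fun n : ℕ => r ^ n * u n) {m : ℕ}
    (hlt : ∀ n < m, a ≤ u n) (hge : ∀ n, m ≤ n → u n ≤ a) :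
    cutSum r a u m = ∑' n : ℕ, r ^ n * min (u n) a := by
  have hs : Summable fun n : ℕ => r ^ n * min (u n) a :=
    hu.of_nonneg_of_le (fun n => mul_nonneg (pow_nonneg hr n) (le_min (hu0 n) ha))
      fun n => mul_le_mul_of_nonneg_left (min_le_left _ _) (pow_nonneg hr n)
  rw [← hs.sum_add_tsum_nat_add m, cutSum]
  congr 1
  · refine Finset.sum_congr rfl fun n hn => ?_
    rw [min_eq_right (hlt n (Finset.mem_range.1 hn))]
  · refine tsum_congr fun l => ?_
    rw [min_eq_left (hge _ (Nat.le_add_left m l))]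

lemma tsum_mul_min_add_le {r a : ℝ} {x y : ℕ → ℝ} (hr : 0 ≤ r) (ha : 0 ≤ a)
    (hx0 : ∀ n, 0 ≤ x n) (hy0 : ∀ n, 0 ≤ y n)
    (hx : Summable fun n : ℕ => r ^ n * x n) (hy : Summable fun n : ℕ => r ^ n * y n) :
    ∑' n : ℕ, r ^ n * min (x n + y n) a ≤
      2 * max (∑' n : ℕ, r ^ n * min (y n) a) (∑' n : ℕ, r ^ n * min (x n) a) := by
  have hs {z : ℕ → ℝ} (hz0 : ∀ n, 0 ≤ z n) (hz : Summable fun n : ℕ => r ^ n * z n) :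
      Summable fun n : ℕ => r ^ n * min (z n) a :=
    hz.of_nonneg_of_le (fun n => mul_nonneg (pow_nonneg hr n) (le_min (hz0 n) ha))
      fun n => mul_le_mul_of_nonneg_left (min_le_left _ _) (pow_nonneg hr n)
  have hxy : Summable fun n : ℕ => r ^ n * (x n + y n) := by
    simpa only [mul_add] using hx.add hy
  have hle : ∑' n : ℕ, r ^ n * min (x n + y n) a ≤
      ∑' n : ℕ, (r ^ n * min (x n) a + r ^ n * min (y n) a) := by
    refine (hs (fun n => add_nonneg (hx0 n) (hy0 n)) hxy).tsum_le_tsum (fun n => ?_)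
      ((hs hx0 hx).add (hs hy0 hy))
    rw [← mul_add]
    refine mul_le_mul_of_nonneg_left ?_ (pow_nonneg hr n)
    have := hx0 n
    have := hy0 n
    grind
  rw [(hs hx0 hx).tsum_add (hs hy0 hy)] at hle
  have := le_max_left (∑' n : ℕ, r ^ n * min (y n) a) (∑' n : ℕ, r ^ n * min (x n) a)
  have := le_max_right (∑' n : ℕ, r ^ n * min (y n) a) (∑' n : ℕ, r ^ n * min (x n) a)
  linarith

lemma cutSum_le_cutSum_add {r a : ℝ} {u : ℕ → ℝ} (hr : 1 < r) (hu0 : ∀ n, 0 ≤ u n)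
    (hu : Summable fun n : ℕ => r ^ n * u n) {k m : ℕ} (hkm : k ≤ m) :
    cutSum r a u (m + 1) ≤ cutSum r a u (k + 1) + r / (r - 1) * (r ^ m - r ^ k) * a := by
  have hr0 : 0 ≤ r := by linarith
  have hgeom : ∑ n ∈ Finset.Ico (k + 1) (m + 1), r ^ n * a =
      r / (r - 1) * (r ^ m - r ^ k) * a := by
    rw [← Finset.sum_mul, geom_sum_Ico hr.ne' (Nat.add_le_add_right hkm 1)]
    ring
  rw [cutSum_eq_add_sum_Ico hu (Nat.add_le_add_right hkm 1), ← hgeom]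
  gcongr with n
  linarith [hu0 n]

/-- Two truncated series cut at a common index `k` after which the combined constant terms
dominate, compared with the same series cut at their own optimal indices `k₂ ≤ k₁`. -/
lemma cutSum_add_cutSum_le {r₁ r₂ a₁ a₂ : ℝ} {u₁ u₂ : ℕ → ℝ} (hr₁ : 0 < r₁) (hr₂ : 1 < r₂)
    (hu₂0 : ∀ n, 0 ≤ u₂ n)
    (hu₁ : Summable fun n : ℕ => r₁ ^ n * u₁ n) (hu₂ : Summable fun n : ℕ => r₂ ^ n * u₂ n)
    {k k₁ k₂ : ℕ} (hk₁max : ∀ l, a₁ ≤ u₁ l → l ≤ k₁) (hk₂max : ∀ l, a₂ ≤ u₂ l → l ≤ k₂)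
    (hkmem : r₁ ^ k * a₁ + r₂ ^ k * a₂ ≤ r₁ ^ k * u₁ k + r₂ ^ k * u₂ k)
    (hkmax : ∀ l, r₁ ^ l * a₁ + r₂ ^ l * a₂ ≤ r₁ ^ l * u₁ l + r₂ ^ l * u₂ l → l ≤ k)
    (h : k₂ ≤ k₁) :
    cutSum r₁ a₁ u₁ (k + 1) + cutSum r₂ a₂ u₂ (k + 1) ≤
      cutSum r₁ a₁ u₁ (k₁ + 1) + cutSum r₂ a₂ u₂ (k₂ + 1) +
        r₂ / (r₂ - 1) * (r₂ ^ k₁ - r₂ ^ k₂) * a₂ := by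
  have hr₂0 : 0 < r₂ := by linarith
  have hk : k ≤ k₁ := by
    by_contra! hlt
    have h₁ : u₁ k < a₁ := by
      by_contra! hle
      exact absurd (hk₁max k hle) (by omega)
    have h₂ : u₂ k < a₂ := by
      by_contra! hle
      exact absurd (hk₂max k hle) (by omega)
    have := mul_lt_mul_of_pos_left h₁ (pow_pos hr₁ k)
    have := mul_lt_mul_of_pos_left h₂ (pow_pos hr₂0 k)
    linarith
  have hsum : 0 ≤ ∑ n ∈ Finset.Ico (k + 1) (k₁ + 1),
      (r₁ ^ n * (a₁ - u₁ n) + r₂ ^ n * (a₂ - u₂ n)) := by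
    refine Finset.sum_nonneg fun n hn => ?_
    by_contra! hneg
    have := hkmax n (by linarith)
    have := (Finset.mem_Ico.1 hn).1
    omega
  rw [Finset.sum_add_distrib] at hsum
  have e₁ := cutSum_eq_add_sum_Ico (a := a₁) hu₁ (Nat.add_le_add_right hk 1)
  have e₂ := cutSum_eq_add_sum_Ico (a := a₂) hu₂ (Nat.add_le_add_right hk 1)
  have := cutSum_le_cutSum_add (a := a₂) hr₂ hu₂0 hu₂ h
  linarith

lemma sInf_image_antitone {T : Type*} {f : T → ℝ} (hf : ∀ y, 0 ≤ f y) {S : ℕ → Finset T}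
    (hne : ∀ n, (S n).Nonempty) (hmono : ∀ n, S n ⊆ S (n + 1)) :
    Antitone fun n => sInf (f '' (S n : Set T)) := by
  refine antitone_nat_of_succ_le fun n => csInf_le_csInf ⟨0, ?_⟩ ?_ ?_
  · rintro _ ⟨y, -, rfl⟩
    exact hf y
  · exact (Finset.coe_nonempty.2 (hne n)).image f
  · exact Set.image_mono (Finset.coe_subset.2 (hmono n))

lemma cutSum_add_le_two_mul_max {r a : ℝ} {x y : ℕ → ℝ} (hr : 0 ≤ r) (ha : 0 ≤ a)
    (hx0 : ∀ n, 0 ≤ x n) (hy0 : ∀ n, 0 ≤ y n) (hxa : Antitone x) (hya : Antitone y)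
    (hx : Summable fun n : ℕ => r ^ n * x n) (hy : Summable fun n : ℕ => r ^ n * y n)
    {k : ℕ} (hmem : a ≤ x k + y k) (hmax : ∀ l, a ≤ x l + y l → l ≤ k) :
    cutSum r a (fun n => x n + y n) (k + 1) ≤
      2 * max (∑' n : ℕ, r ^ n * min (y n) a) (∑' n : ℕ, r ^ n * min (x n) a) := by
  rw [cutSum_eq_tsum_min hr ha (fun n => add_nonneg (hx0 n) (hy0 n))
    (by simpa only [mul_add] using hx.add hy)]
  · exact tsum_mul_min_add_le hr ha hx0 hy0 hx hy
  · intro n hn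
    exact hmem.trans (add_le_add (hxa (Nat.lt_succ_iff.1 hn)) (hya (Nat.lt_succ_iff.1 hn)))
  · intro n hn
    by_contra! hlt
    have := hmax n hlt.le
    omega

lemma cutSum_add {r a : ℝ} {x y : ℕ → ℝ} (hr : 1 < r)
    (hx : Summable fun n : ℕ => r ^ n * x n) (hy : Summable fun n : ℕ => r ^ n * y n) (m : ℕ) :
    cutSum r a (fun n => x n + y n) m =
      ∑' l : ℕ, r ^ (l + m) * x (l + m) + ∑' l : ℕ, r ^ (l + m) * y (l + m) +
        (r ^ m - 1) / (r - 1) * a := by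
  have hx' := (summable_nat_add_iff m).2 hx
  have hy' := (summable_nat_add_iff m).2 hy
  simp only [cutSum, mul_add]
  rw [hx'.tsum_add hy', ← Finset.sum_mul, geom_sum_eq hr.ne']
  ring

/-- For all `s, t ∈ T`, writing `k₁ = k¹(s,t)`, `k₂ = k²(s,t)`, the combined bound `τ̄` admits
the upper estimate
`τ̄(s,t) ≤ 2(τ₁(s,t) + τ₂(s,t)) + (2^{p₂}/(2^{p₂}-1))(2^{k₁p₂} - 2^{k₂p₂}) d₂(s,t) 1_{k₁≥k₂}
+ (2^{p₁}/(2^{p₁}-1))(2^{k₂p₁} - 2^{k₁p₁}) d₁(s,t) 1_{k₂≥k₁}`. -/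
theorem stmt_12
    {T : Type*} (d₁ d₂ : T → T → ℝ)
    (hd₁0 : ∀ x y, 0 ≤ d₁ x y) (hd₁symm : ∀ x y, d₁ x y = d₁ y x)
    (hd₁refl : ∀ x, d₁ x x = 0) (hd₁tri : ∀ x y z, d₁ x z ≤ d₁ x y + d₁ y z)
    (hd₂0 : ∀ x y, 0 ≤ d₂ x y) (hd₂symm : ∀ x y, d₂ x y = d₂ y x)
    (hd₂refl : ∀ x, d₂ x x = 0) (hd₂tri : ∀ x y z, d₂ x z ≤ d₂ x y + d₂ y z)
    (p₁ p₂ : ℝ) (hp₁ : 1 ≤ p₁) (hp₂ : 1 ≤ p₂)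
    (Tn : ℕ → Finset T)
    (hTne : ∀ n, (Tn n).Nonempty)
    (hTmono : ∀ n, Tn n ⊆ Tn (n + 1))
    (hTdense : ∀ x : T, ∀ ε > (0:ℝ), ∃ n, ∃ u ∈ Tn n, d₁ x u < ε ∧ d₂ x u < ε)
    (D₁ D₂ : T → ℕ → ℝ)
    (hD₁ : ∀ x n, D₁ x n = sInf ((d₁ x) '' (Tn n : Set T)))
    (hD₂ : ∀ x n, D₂ x n = sInf ((d₂ x) '' (Tn n : Set T)))
    (hsum₁ : ∀ x, Summable fun n : ℕ => (2:ℝ) ^ (p₁ * n) * D₁ x n)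
    (hsum₂ : ∀ x, Summable fun n : ℕ => (2:ℝ) ^ (p₂ * n) * D₂ x n)
    (σ₁ σ₂ : ℕ → T → ℝ)
    (hσ₁ : ∀ m x, σ₁ m x = ∑' l : ℕ, (2:ℝ) ^ (p₁ * ((l + m : ℕ) : ℝ)) * D₁ x (l + m))
    (hσ₂ : ∀ m x, σ₂ m x = ∑' l : ℕ, (2:ℝ) ^ (p₂ * ((l + m : ℕ) : ℝ)) * D₂ x (l + m))
    (τ₁ τ₂ : T → T → ℝ)
    (hτ₁ : ∀ s t, τ₁ s t =
      max (∑' n : ℕ, (2:ℝ) ^ (p₁ * n) * min (D₁ t n) (d₁ s t))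
          (∑' n : ℕ, (2:ℝ) ^ (p₁ * n) * min (D₁ s n) (d₁ s t)))
    (hτ₂ : ∀ s t, τ₂ s t =
      max (∑' n : ℕ, (2:ℝ) ^ (p₂ * n) * min (D₂ t n) (d₂ s t))
          (∑' n : ℕ, (2:ℝ) ^ (p₂ * n) * min (D₂ s n) (d₂ s t)))
    (s t : T) (k k₁ k₂ : ℕ)
    (hk₁mem : D₁ s k₁ + D₁ t k₁ ≥ d₁ s t)
    (hk₁max : ∀ l : ℕ, D₁ s l + D₁ t l ≥ d₁ s t → l ≤ k₁)
    (hk₂mem : D₂ s k₂ + D₂ t k₂ ≥ d₂ s t)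
    (hk₂max : ∀ l : ℕ, D₂ s l + D₂ t l ≥ d₂ s t → l ≤ k₂)
    (hkmem : (2:ℝ) ^ (p₁ * k) * (D₁ s k + D₁ t k) + (2:ℝ) ^ (p₂ * k) * (D₂ s k + D₂ t k) ≥
      (2:ℝ) ^ (p₁ * k) * d₁ s t + (2:ℝ) ^ (p₂ * k) * d₂ s t)
    (hkmax : ∀ l : ℕ,
      (2:ℝ) ^ (p₁ * l) * (D₁ s l + D₁ t l) + (2:ℝ) ^ (p₂ * l) * (D₂ s l + D₂ t l) ≥
        (2:ℝ) ^ (p₁ * l) * d₁ s t + (2:ℝ) ^ (p₂ * l) * d₂ s t → l ≤ k) :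
    (σ₁ (k + 1) s + σ₁ (k + 1) t + σ₂ (k + 1) s + σ₂ (k + 1) t) +
      ((2:ℝ) ^ (p₁ * ((k : ℝ) + 1)) - 1) / ((2:ℝ) ^ p₁ - 1) * d₁ s t +
      ((2:ℝ) ^ (p₂ * ((k : ℝ) + 1)) - 1) / ((2:ℝ) ^ p₂ - 1) * d₂ s t ≤
    2 * (τ₁ s t + τ₂ s t) +
      (2:ℝ) ^ p₂ / ((2:ℝ) ^ p₂ - 1) * ((2:ℝ) ^ ((k₁ : ℝ) * p₂) - (2:ℝ) ^ ((k₂ : ℝ) * p₂)) *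
        d₂ s t * (if k₂ ≤ k₁ then 1 else 0) +
      (2:ℝ) ^ p₁ / ((2:ℝ) ^ p₁ - 1) * ((2:ℝ) ^ ((k₂ : ℝ) * p₁) - (2:ℝ) ^ ((k₁ : ℝ) * p₁)) *
        d₁ s t * (if k₁ ≤ k₂ then 1 else 0) := by
  have hr {p : ℝ} (hp : 1 ≤ p) : 1 < (2:ℝ) ^ p :=
    Real.one_lt_rpow one_lt_two (by linarith)
  have hr₁ := hr hp₁
  have hr₂ := hr hp₂
  have hpow (p : ℝ) (n : ℕ) : (2:ℝ) ^ (p * n) = ((2:ℝ) ^ p) ^ n :=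
    Real.rpow_mul_natCast zero_le_two p n
  have hpow' (p : ℝ) (n : ℕ) : (2:ℝ) ^ ((n : ℝ) * p) = ((2:ℝ) ^ p) ^ n := by
    rw [mul_comm, hpow]
  have hpow_succ (p : ℝ) : (2:ℝ) ^ (p * ((k : ℝ) + 1)) = ((2:ℝ) ^ p) ^ (k + 1) := by
    rw [← hpow]
    push_cast
    rfl
  simp only [hpow_succ, hpow, hpow', hσ₁, hσ₂, hτ₁, hτ₂] at *
  have hD₁0 (x : T) (n : ℕ) : 0 ≤ D₁ x n := by
    rw [hD₁]
    exact Real.sInf_nonneg (by rintro _ ⟨y, -, rfl⟩; exact hd₁0 x y)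
  have hD₂0 (x : T) (n : ℕ) : 0 ≤ D₂ x n := by
    rw [hD₂]
    exact Real.sInf_nonneg (by rintro _ ⟨y, -, rfl⟩; exact hd₂0 x y)
  have hD₁anti (x : T) : Antitone (D₁ x) := by
    rw [funext (hD₁ x)]
    exact sInf_image_antitone (hd₁0 x) hTne hTmono
  have hD₂anti (x : T) : Antitone (D₂ x) := by
    rw [funext (hD₂ x)]
    exact sInf_image_antitone (hd₂0 x) hTne hTmono
  generalize (2:ℝ) ^ p₁ = r₁ at *
  generalize (2:ℝ) ^ p₂ = r₂ at *
  have hu₁ : Summable fun n : ℕ => r₁ ^ n * (D₁ s n + D₁ t n) := by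
    simpa only [mul_add] using (hsum₁ s).add (hsum₁ t)
  have hu₂ : Summable fun n : ℕ => r₂ ^ n * (D₂ s n + D₂ t n) := by
    simpa only [mul_add] using (hsum₂ s).add (hsum₂ t)
  have b₁ := cutSum_add_le_two_mul_max (by linarith) (hd₁0 s t) (hD₁0 s) (hD₁0 t) (hD₁anti s)
    (hD₁anti t) (hsum₁ s) (hsum₁ t) hk₁mem hk₁max
  have b₂ := cutSum_add_le_two_mul_max (by linarith) (hd₂0 s t) (hD₂0 s) (hD₂0 t) (hD₂anti s)
    (hD₂anti t) (hsum₂ s) (hsum₂ t) hk₂mem hk₂max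
  have e₁ := cutSum_add (a := d₁ s t) hr₁ (hsum₁ s) (hsum₁ t) (k + 1)
  have e₂ := cutSum_add (a := d₂ s t) hr₂ (hsum₂ s) (hsum₂ t) (k + 1)
  rcases lt_trichotomy k₂ k₁ with h | h | h
  · have := cutSum_add_cutSum_le (by linarith) hr₂ (fun n => add_nonneg (hD₂0 s n) (hD₂0 t n)) hu₁ hu₂
      hk₁max hk₂max hkmem hkmax h.le
    rw [if_pos h.le, if_neg h.not_ge]
    linarith
  · subst h
    have := cutSum_add_cutSum_le (by linarith) hr₂ (fun n => add_nonneg (hD₂0 s n) (hD₂0 t n)) hu₁ hu₂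
      hk₁max hk₂max hkmem hkmax le_rfl
    simp only [sub_self, mul_zero, zero_mul] at this ⊢
    linarith
  · have := cutSum_add_cutSum_le (by linarith) hr₁ (fun n => add_nonneg (hD₁0 s n) (hD₁0 t n)) hu₂ hu₁
      hk₂max hk₁max (by linarith) (fun l hl => hkmax l (by linarith)) h.le
    rw [if_pos h.le, if_neg h.not_ge]
    linarith
end
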